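/- The function J(x) = max_{y∈Y} F(x,y) is Lipschitz smooth with constant L_J = L_f + L_f²/μ: for all x, x′ ∈ ℝ^{p1}, ‖∇J(x) − ∇J(x′)‖ ≤ (L_f + L_f²/μ)·‖x − x′‖. -/

import Mathlib

open scoped RealInnerProductSpace

/-- `J` is Lipschitz smooth with constant `L_J = L_f + L_f²/μ`. -/

theorem stmt_2
    (p1 p2 : ℕ)
    (F : EuclideanSpace ℝ (Fin p1) → EuclideanSpace ℝ (Fin p2) → ℝ)
    (Lf μ : ℝ) (hLf : 0 < Lf) (hμ : 0 < μ)
    (Y : Set (EuclideanSpace ℝ (Fin p2)))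
    (hYne : Y.Nonempty) (hYclosed : IsClosed Y) (hYconvex : Convex ℝ Y)
    (hdiffx : ∀ y, Differentiable ℝ (fun x => F x y))
    (hdiffy : ∀ x, Differentiable ℝ (fun y => F x y))
    -- `L_f`-Lipschitz continuity of the (joint) gradient of `F`
    (hlip : ∀ x x' y y',
      ‖gradient (fun u => F u y) x - gradient (fun u => F u y') x'‖ ^ 2
        + ‖gradient (fun v => F x v) y - gradient (fun v => F x' v) y'‖ ^ 2
      ≤ Lf ^ 2 * (‖x - x'‖ ^ 2 + ‖y - y'‖ ^ 2))
    -- `μ`-strong concavity of `y ↦ F x y` for every fixed `x`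
    (hconc : ∀ x y y', F x y' ≤ F x y + ⟪gradient (fun v => F x v) y, y' - y⟫
      - μ / 2 * ‖y' - y‖ ^ 2)
    -- `y*(x)` is the unique maximizer of `F x ·` over `Y`
    (ystar : EuclideanSpace ℝ (Fin p1) → EuclideanSpace ℝ (Fin p2))
    (hystar_mem : ∀ x, ystar x ∈ Y)
    (hystar_max : ∀ x, IsMaxOn (fun y => F x y) Y (ystar x))
    (hystar_uniq : ∀ x y, y ∈ Y → IsMaxOn (fun y' => F x y') Y y → y = ystar x)
    -- `J(x) = max_{y ∈ Y} F(x, y)`, i.e. `J x` is the greatest value of `F x ·` on `Y`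
    (J : EuclideanSpace ℝ (Fin p1) → ℝ)
    (hJ : ∀ x, IsGreatest ((fun y => F x y) '' Y) (J x)) :
    ∀ x x', ‖gradient J x - gradient J x'‖ ≤ (Lf + Lf ^ 2 / μ) * ‖x - x'‖ := by
  have hsq : ∀ a b : ℝ, 0 ≤ b → a ^ 2 ≤ b ^ 2 → a ≤ b := fun a b hb h =>
    (le_abs_self a).trans (abs_le_of_sq_le_sq h hb)
  have hgx : ∀ x x' y, ‖gradient (fun u => F u y) x - gradient (fun u => F u y) x'‖
      ≤ Lf * ‖x - x'‖ := by
    intro x x' y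
    apply hsq _ _ (by positivity)
    have := hlip x x' y y
    simp only [sub_self, norm_zero] at this
    nlinarith [sq_nonneg ‖gradient (fun v => F x v) y - gradient (fun v => F x' v) y‖]
  have hgxy : ∀ x y y', ‖gradient (fun u => F u y) x - gradient (fun u => F u y') x‖
      ≤ Lf * ‖y - y'‖ := by
    intro x y y'
    apply hsq _ _ (by positivity)
    have := hlip x x y y'
    simp only [sub_self, norm_zero] at this
    nlinarith [sq_nonneg ‖gradient (fun v => F x v) y - gradient (fun v => F x v) y'‖]
  have hgy : ∀ x x' y, ‖gradient (fun v => F x v) y - gradient (fun v => F x' v) y‖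
      ≤ Lf * ‖x - x'‖ := by
    intro x x' y
    apply hsq _ _ (by positivity)
    have := hlip x x' y y
    simp only [sub_self, norm_zero] at this
    nlinarith [sq_nonneg ‖gradient (fun u => F u y) x - gradient (fun u => F u y) x'‖]
  have hopt : ∀ x, ∀ y ∈ Y, ⟪gradient (fun v => F x v) (ystar x), y - ystar x⟫ ≤ 0 := by
    intro x y hy
    have h1 := ((hdiffy x) (ystar x)).hasGradientAt.hasFDerivAt
    have h2 := (hystar_max x).localize.hasFDerivWithinAt_nonpos h1.hasFDerivWithinAt
      (sub_mem_posTangentConeAt_of_segment_subset (hYconvex.segment_subset (hystar_mem x) hy))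
    simpa using h2
  have hy : ∀ x x', ‖ystar x - ystar x'‖ ≤ Lf / μ * ‖x - x'‖ := by
    intro x x'
    have a1 := hconc x (ystar x) (ystar x')
    have a2 := hconc x (ystar x') (ystar x)
    have a3 := hopt x _ (hystar_mem x')
    have a4 := hopt x' _ (hystar_mem x)
    have a5 := real_inner_le_norm (gradient (fun v => F x v) (ystar x')
      - gradient (fun v => F x' v) (ystar x')) (ystar x - ystar x')
    rw [inner_sub_left] at a5
    rw [norm_sub_rev (ystar x') (ystar x)] at a1
    have a6 := mul_le_mul_of_nonneg_right (hgy x x' (ystar x')) (norm_nonneg (ystar x - ystar x'))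
    have a7 : μ * ‖ystar x - ystar x'‖ ^ 2 ≤ Lf * ‖x - x'‖ * ‖ystar x - ystar x'‖ := by linarith
    rcases (norm_nonneg (ystar x - ystar x')).eq_or_lt with h | h
    · rw [← h]; positivity
    · have : μ * ‖ystar x - ystar x'‖ ≤ Lf * ‖x - x'‖ := by
        apply le_of_mul_le_mul_right _ h
        nlinarith
      rw [div_mul_eq_mul_div, le_div_iff₀ hμ]; linarith
  have hJe : ∀ x, J x = F x (ystar x) := by
    intro x
    refine (hJ x).unique ⟨⟨_, hystar_mem x, rfl⟩, ?_⟩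
    rintro _ ⟨y, hy, rfl⟩
    exact hystar_max x hy
  have hmv : ∀ x x' y, |F x' y - F x y - ⟪gradient (fun u => F u y) x, x' - x⟫|
      ≤ Lf * ‖x' - x‖ * ‖x' - x‖ := by
    intro x x' y
    have := (convex_segment x x').norm_image_sub_le_of_norm_hasFDerivWithin_le'
      (f := fun u => F u y) (C := Lf * ‖x' - x‖)
      (φ := InnerProductSpace.toDual ℝ _ (gradient (fun u => F u y) x))
      (fun z _ => ((hdiffx y) z).hasGradientAt.hasFDerivAt.hasFDerivWithinAt)
      (fun z hz => by
        rw [← map_sub, LinearIsometryEquiv.norm_map]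
        refine (hgx z x y).trans ?_
        gcongr
        exact norm_sub_le_of_mem_segment hz)
      (left_mem_segment ℝ x x') (right_mem_segment ℝ x x')
    simpa using this
  have hquad : ∀ x x', |J x' - J x - ⟪gradient (fun u => F u (ystar x)) x, x' - x⟫|
      ≤ (Lf + Lf ^ 2 / μ) * ‖x' - x‖ ^ 2 := by
    intro x x'
    have b1 := abs_le.1 (hmv x x' (ystar x))
    have b2 := abs_le.1 (hmv x x' (ystar x'))
    have b3 : F x' (ystar x) ≤ F x' (ystar x') := hystar_max x' (hystar_mem x)
    have b4 : F x (ystar x') ≤ F x (ystar x) := hystar_max x (hystar_mem x')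
    have b5 := real_inner_le_norm (gradient (fun u => F u (ystar x')) x
      - gradient (fun u => F u (ystar x)) x) (x' - x)
    rw [inner_sub_left] at b5
    have b6 : ‖gradient (fun u => F u (ystar x')) x - gradient (fun u => F u (ystar x)) x‖
      * ‖x' - x‖ ≤ (Lf * (Lf / μ * ‖x' - x‖)) * ‖x' - x‖ := by
      gcongr
      refine (hgxy _ _ _).trans ?_
      gcongr
      exact hy _ _
    have b7 : (Lf + Lf ^ 2 / μ) * ‖x' - x‖ ^ 2 = Lf * ‖x' - x‖ * ‖x' - x‖
      + (Lf * (Lf / μ * ‖x' - x‖)) * ‖x' - x‖ := by ring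
    have b8 : 0 ≤ (Lf * (Lf / μ * ‖x' - x‖)) * ‖x' - x‖ := by positivity
    rw [hJe, hJe, abs_le, b7]
    constructor <;> linarith [b1.1, b2.2]
  have hgrad : ∀ x, gradient J x = gradient (fun u => F u (ystar x)) x := by
    intro x
    apply HasGradientAt.gradient
    rw [hasGradientAt_iff_isLittleO]
    have hO : (fun x' => J x' - J x - ⟪gradient (fun u => F u (ystar x)) x, x' - x⟫)
        =O[nhds x] (fun x' => ‖x' - x‖ ^ 2) :=
      Asymptotics.IsBigO.of_bound (Lf + Lf ^ 2 / μ) (Filter.Eventually.of_forall fun x' => by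
        simpa using hquad x x')
    exact hO.trans_isLittleO (Asymptotics.isLittleO_pow_sub_sub x one_lt_two)
  intro x x'
  rw [hgrad, hgrad]
  have c1 := hgx x x' (ystar x)
  have c2 := hgxy x' (ystar x) (ystar x')
  have c3 := mul_le_mul_of_nonneg_left (hy x x') hLf.le
  have c4 := norm_sub_le_norm_sub_add_norm_sub (gradient (fun u => F u (ystar x)) x)
    (gradient (fun u => F u (ystar x)) x') (gradient (fun u => F u (ystar x')) x')
  have c5 : (Lf + Lf ^ 2 / μ) * ‖x - x'‖ = Lf * ‖x - x'‖ + Lf * (Lf / μ * ‖x - x'‖) := by ring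
  linarith
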